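/- Let λ > −1/2 with λ ∉ {0, 1/2}, and let n₀ be a nonnegative integer. Suppose C > 0 is a constant such that for every real polynomial f whose Gegenbauer coefficients satisfy f̂_j^λ = 0 for all 0 ≤ j ≤ n₀, letting g be the polynomial with ĝ_0^λ = 0 and ĝ_n^λ = (n(n+2λ))^{1/2} f̂_n^λ for n ≥ 1, the inequality c_λ ∫_{−1}^{1} f(t)² w_λ(t) dt ≤ C · c_λ ∫_{−1}^{1} (1−t) g(t)² w_λ(t) dt holds. Then C ≥ 8/(2λ−1)². -/

import Mathlib

open MeasureTheory Real

/-- The Gegenbauer weight `w_λ(t) = (1-t²)^{λ-1/2}` on `[-1,1]`. -/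
noncomputable def gegenWeight (lam t : ℝ) : ℝ := (1 - t ^ 2) ^ (lam - 1 / 2)

/-- The normalization constant `c_λ = Γ(λ+1)/(√π Γ(λ+1/2))`,
so that `c_λ ∫_{-1}^1 w_λ(t) dt = 1`. -/
noncomputable def gegenConst (lam : ℝ) : ℝ :=
  Real.Gamma (lam + 1) / (Real.sqrt Real.pi * Real.Gamma (lam + 1 / 2))

/-- The Gegenbauer polynomials `C_n^λ`, defined by the three-term recurrence
`C_0^λ(t) = 1`, `C_1^λ(t) = 2λt`,
`n C_n^λ(t) = 2(n+λ-1) t C_{n-1}^λ(t) - (n+2λ-2) C_{n-2}^λ(t)`. -/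
noncomputable def gegenPoly (lam : ℝ) : ℕ → ℝ → ℝ
  | 0 => fun _ => 1
  | 1 => fun t => 2 * lam * t
  | (n + 2) => fun t =>
      (2 * ((n : ℝ) + 2 + lam - 1) * t * gegenPoly lam (n + 1) t
        - ((n : ℝ) + 2 + 2 * lam - 2) * gegenPoly lam n t) / ((n : ℝ) + 2)

/-- The normalization `h_n^λ = λ (2λ)_n / ((n+λ) n!)`. -/
noncomputable def gegenNorm (lam : ℝ) (n : ℕ) : ℝ :=
  lam * (ascPochhammer ℝ n).eval (2 * lam) / (((n : ℝ) + lam) * (n.factorial : ℝ))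

/-- The Gegenbauer coefficients
`f̂_n^λ = (h_n^λ)^{-1/2} c_λ ∫_{-1}^1 f(s) C_n^λ(s) w_λ(s) ds`. -/
noncomputable def gegenCoeff (lam : ℝ) (f : ℝ → ℝ) (n : ℕ) : ℝ :=
  (Real.sqrt (gegenNorm lam n))⁻¹ * gegenConst lam *
    ∫ s in (-1 : ℝ)..1, f s * gegenPoly lam n s * gegenWeight lam s

/-- `γ_n = ((n+2λ)(n+1)/((n+λ)(n+λ+1)))^{1/2}`. -/
noncomputable def gegenGamma (lam : ℝ) (n : ℕ) : ℝ :=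
  Real.sqrt (((n : ℝ) + 2 * lam) * ((n : ℝ) + 1) / (((n : ℝ) + lam) * ((n : ℝ) + lam + 1)))

open Polynomial in
/-- The Gegenbauer polynomials as elements of `ℝ[X]`. -/
noncomputable def gegenPolynomial (lam : ℝ) : ℕ → Polynomial ℝ
  | 0 => 1
  | 1 => C (2 * lam) * X
  | (n + 2) => C ((n : ℝ) + 2)⁻¹ *
      (C (2 * ((n : ℝ) + 1 + lam)) * X * gegenPolynomial lam (n + 1)
        - C ((n : ℝ) + 2 * lam) * gegenPolynomial lam n)

theorem eval_gegenPolynomial (lam : ℝ) (n : ℕ) (t : ℝ) :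
    (gegenPolynomial lam n).eval t = gegenPoly lam n t := by
  induction n using Nat.twoStepInduction with
  | zero => simp [gegenPolynomial, gegenPoly]
  | one => simp [gegenPolynomial, gegenPoly]
  | more n ih0 ih1 =>
    simp only [gegenPolynomial, gegenPoly, Polynomial.eval_mul, Polynomial.eval_sub,
      Polynomial.eval_C, Polynomial.eval_X, ih0, ih1]
    field_simp
    ring

open Polynomial in
theorem gegenPolynomial_recurrence (lam : ℝ) (n : ℕ) :
    C ((n : ℝ) + 2) * gegenPolynomial lam (n + 2) =
      C (2 * ((n : ℝ) + 1 + lam)) * X * gegenPolynomial lam (n + 1)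
        - C ((n : ℝ) + 2 * lam) * gegenPolynomial lam n := by
  have h : ((n : ℝ) + 2) ≠ 0 := by positivity
  rw [gegenPolynomial, ← mul_assoc, ← C_mul, mul_inv_cancel₀ h, C_1, one_mul]

open Polynomial in
theorem gegenPolynomial_derivative_ladder (lam : ℝ) (n : ℕ) :
    ((1 - X ^ 2) * derivative (gegenPolynomial lam n) =
      C ((n : ℝ) + 2 * lam) * X * gegenPolynomial lam n
        - C ((n : ℝ) + 1) * gegenPolynomial lam (n + 1)) ∧
    ((1 - X ^ 2) * derivative (gegenPolynomial lam (n + 1)) =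
      C ((n : ℝ) + 2 * lam) * gegenPolynomial lam n
        - C ((n : ℝ) + 1) * X * gegenPolynomial lam (n + 1)) := by
  induction n with
  | zero =>
    constructor
    · simp [gegenPolynomial]
    · simp [gegenPolynomial]
      ring
  | succ n ih =>
    obtain ⟨ih0, ih1⟩ := ih
    have hr := gegenPolynomial_recurrence lam n
    have hd := congrArg derivative hr
    simp only [derivative_mul, derivative_sub, derivative_C, derivative_X, zero_mul, zero_add,
      mul_one] at hd
    have h : ((n : ℝ) + 2) ≠ 0 := by positivity
    have hC : C ((n : ℝ) + 2) ≠ 0 := C_ne_zero.mpr h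
    have h2 : (C (2 : ℝ) : ℝ[X]) = 2 := rfl
    have e1 : ((n + 1 : ℕ) : ℝ) = n + 1 := by push_cast; rfl
    rw [e1]
    simp only [C_add, C_mul, C_1, h2] at ih0 ih1 hr hd hC ⊢
    refine ⟨?_, ?_⟩
    · have e2 : n + 1 + 1 = n + 2 := rfl
      rw [e2]
      linear_combination ih1 + hr
    · have e2 : n + 1 + 1 = n + 2 := rfl
      rw [e2]
      apply mul_left_cancel₀ hC
      linear_combination (1 - X ^ 2) * hd + 2 * (C (n:ℝ) + 1 + C lam) * X * ih1
        - (C (n:ℝ) + 2 * C lam) * ih0 + (C (n:ℝ) + 2) * X * hr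

open Polynomial in
theorem gegenPolynomial_differential_equation (lam : ℝ) (n : ℕ) :
    (1 - X ^ 2) * derivative (derivative (gegenPolynomial lam n)) -
      C (2 * lam + 1) * X * derivative (gegenPolynomial lam n) =
      - C ((n : ℝ) * (n + 2 * lam)) * gegenPolynomial lam n := by
  cases n with
  | zero => simp [gegenPolynomial]
  | succ n =>
    obtain ⟨h0, h1⟩ := gegenPolynomial_derivative_ladder lam n
    have hd := congrArg derivative h1
    have hX : (1 - X ^ 2 : ℝ[X]) ≠ 0 := by
      intro h
      have := congrArg (eval 0) h
      simp at this
    have e1 : ((n + 1 : ℕ) : ℝ) = n + 1 := by push_cast; rfl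
    have e3 : (C (2:ℝ) : ℝ[X]) = 2 := rfl
    rw [e1]
    have e4 : (C (n : ℝ) : ℝ[X]) = n := rfl
    simp only [derivative_mul, derivative_sub, derivative_X, mul_one, derivative_X_pow,
      derivative_one, C_add, C_mul, C_1, e3, e4, Nat.cast_ofNat] at h0 h1 hd ⊢
    apply mul_left_cancel₀ hX
    norm_num at hd
    linear_combination (1 - X ^ 2) * hd + ((n : ℝ[X]) + 2 * C lam) * h0
      - ((n : ℝ[X]) + 2 * C lam) * X * h1

theorem intervalIntegrable_gegenWeight {lam : ℝ} (hlam : -1 / 2 < lam) :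
    IntervalIntegrable (gegenWeight lam) volume (-1) 1 := by
  have key : IntervalIntegrable (gegenWeight lam) volume (-1) 0 := by
    have h1 : IntervalIntegrable (fun t : ℝ => (t + 1) ^ (lam - 1 / 2)) volume (-1) 0 := by
      have := (intervalIntegral.intervalIntegrable_rpow' (a := 0) (b := 1)
        (r := lam - 1 / 2) (by linarith)).comp_add_right 1
      simpa using this
    have h2 : ContinuousOn (fun t : ℝ => (1 - t) ^ (lam - 1 / 2)) (Set.uIcc (-1) 0) := by
      apply ContinuousOn.rpow_const (by fun_prop)
      intro t ht
      rw [Set.uIcc_of_le (by norm_num)] at ht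
      left
      linarith [ht.2]
    refine (h1.mul_continuousOn h2).congr ?_
    intro t ht
    rw [Set.uIoc_of_le (by norm_num)] at ht
    simp only [gegenWeight]
    rw [← Real.mul_rpow (by linarith [ht.1]) (by linarith [ht.2])]
    ring_nf
  have key2 : IntervalIntegrable (gegenWeight lam) volume 0 1 := by
    have h := (IntervalIntegrable.iff_comp_neg (f := gegenWeight lam)).mp key
    have e : (fun t => gegenWeight lam (-t)) = gegenWeight lam := by
      ext t; simp [gegenWeight]
    rw [e] at h
    simpa using h.symm
  exact key.trans key2

theorem intervalIntegrable_eval_mul_gegenWeight {lam : ℝ} (hlam : -1 / 2 < lam)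
    (p : Polynomial ℝ) :
    IntervalIntegrable (fun t => p.eval t * gegenWeight lam t) volume (-1) 1 :=
  (intervalIntegrable_gegenWeight hlam).continuousOn_mul p.continuous.continuousOn

/-- Integration of polynomials against the Gegenbauer weight. -/
noncomputable def gegenIntegral {lam : ℝ} (hlam : -1 / 2 < lam) : Polynomial ℝ →ₗ[ℝ] ℝ where
  toFun p := ∫ t in (-1 : ℝ)..1, p.eval t * gegenWeight lam t
  map_add' p q := by
    simp only [Polynomial.eval_add, add_mul]
    exact intervalIntegral.integral_add (intervalIntegrable_eval_mul_gegenWeight hlam p)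
      (intervalIntegrable_eval_mul_gegenWeight hlam q)
  map_smul' c p := by
    simp [mul_assoc]

theorem gegenIntegral_apply {lam : ℝ} (hlam : -1 / 2 < lam) (p : Polynomial ℝ) :
    gegenIntegral hlam p = ∫ t in (-1 : ℝ)..1, p.eval t * gegenWeight lam t := rfl

theorem gegenIntegral_C_mul {lam : ℝ} (hlam : -1 / 2 < lam) (c : ℝ) (p : Polynomial ℝ) :
    gegenIntegral hlam (Polynomial.C c * p) = c * gegenIntegral hlam p := by
  rw [← Polynomial.smul_eq_C_mul, map_smul, smul_eq_mul]

theorem gegenIntegral_one_pos {lam : ℝ} (hlam : -1 / 2 < lam) :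
    0 < gegenIntegral hlam 1 := by
  simp only [gegenIntegral_apply, Polynomial.eval_one, one_mul]
  apply intervalIntegral.intervalIntegral_pos_of_pos_on (intervalIntegrable_gegenWeight hlam)
  · intro t ht
    exact Real.rpow_pos_of_pos (by nlinarith [ht.1, ht.2]) _
  · norm_num

open Polynomial in
theorem gegenIntegral_by_parts {lam : ℝ} (hlam : -1 / 2 < lam) (p : Polynomial ℝ) :
    gegenIntegral hlam ((1 - X ^ 2) * derivative p - C (2 * lam + 1) * X * p) = 0 := by
  rw [gegenIntegral_apply]
  have hint := intervalIntegrable_eval_mul_gegenWeight hlam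
    ((1 - X ^ 2) * derivative p - C (2 * lam + 1) * X * p)
  rw [intervalIntegral.integral_eq_sub_of_hasDerivAt_of_le (by norm_num)
    (f := fun t => p.eval t * (1 - t ^ 2) ^ (lam + 1 / 2)) ?_ ?_ hint]
  · have h : lam + 1 / 2 ≠ 0 := by linarith
    simp only [one_pow, even_two.neg_pow, sub_self, Real.zero_rpow h, mul_zero]
  · apply ContinuousOn.mul p.continuous.continuousOn
    apply ContinuousOn.rpow_const (by fun_prop)
    intro t _
    right
    linarith
  · intro t ht
    have hpos : 0 < 1 - t ^ 2 := by nlinarith [ht.1, ht.2]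
    have h1 : HasDerivAt (fun t : ℝ => 1 - t ^ 2) (-(2 * t)) t := by
      simpa using (hasDerivAt_pow 2 t).const_sub 1
    have h2 := (p.hasDerivAt t).mul (h1.rpow_const (p := lam + 1 / 2) (Or.inl hpos.ne'))
    refine HasDerivAt.congr_deriv h2 ?_
    have e1 : lam + 1 / 2 - 1 = lam - 1 / 2 := by ring
    have e2 : (1 - t ^ 2) ^ (lam + 1 / 2) = (1 - t ^ 2) * (1 - t ^ 2) ^ (lam - 1 / 2) := by
      rw [← e1, Real.rpow_sub_one hpos.ne']
      field_simp
    simp only [gegenWeight, eval_sub, eval_mul, eval_one, eval_pow, eval_X, eval_C]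
    rw [e1, e2]
    ring

open Polynomial in
theorem gegenIntegral_mul_of_ne {lam : ℝ} (hlam : -1 / 2 < lam) {m n : ℕ} (hmn : m ≠ n) :
    gegenIntegral hlam (gegenPolynomial lam m * gegenPolynomial lam n) = 0 := by
  have h := gegenIntegral_by_parts hlam
    (derivative (gegenPolynomial lam m) * gegenPolynomial lam n
      - derivative (gegenPolynomial lam n) * gegenPolynomial lam m)
  have e : ((1 - X ^ 2) * derivative (derivative (gegenPolynomial lam m) * gegenPolynomial lam n
      - derivative (gegenPolynomial lam n) * gegenPolynomial lam m) -
      C (2 * lam + 1) * X * (derivative (gegenPolynomial lam m) * gegenPolynomial lam n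
      - derivative (gegenPolynomial lam n) * gegenPolynomial lam m)) =
      C ((n : ℝ) * (n + 2 * lam) - (m : ℝ) * (m + 2 * lam)) *
        (gegenPolynomial lam m * gegenPolynomial lam n) := by
    have h1 := gegenPolynomial_differential_equation lam m
    have h2 := gegenPolynomial_differential_equation lam n
    simp only [derivative_sub, derivative_mul, C_sub]
    linear_combination gegenPolynomial lam n * h1 - gegenPolynomial lam m * h2
  rw [e, gegenIntegral_C_mul] at h
  refine (mul_eq_zero.mp h).resolve_left ?_
  have hf : (n : ℝ) * (n + 2 * lam) - (m : ℝ) * (m + 2 * lam) =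
      ((n : ℝ) - m) * (n + m + 2 * lam) := by ring
  rw [hf]
  apply mul_ne_zero
  · rw [sub_ne_zero]
    exact_mod_cast hmn.symm
  · have : (1 : ℝ) ≤ n + m := by
      have : 1 ≤ n + m := by omega
      exact_mod_cast this
    linarith

/-- The squared weighted norm of the `n`-th Gegenbauer polynomial. -/
noncomputable def gegenNormSq {lam : ℝ} (hlam : -1 / 2 < lam) (n : ℕ) : ℝ :=
  gegenIntegral hlam (gegenPolynomial lam n * gegenPolynomial lam n)

open Polynomial in
theorem gegenIntegral_X_mul_succ {lam : ℝ} (hlam : -1 / 2 < lam) (n : ℕ) :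
    2 * ((n : ℝ) + 1 + lam) *
      gegenIntegral hlam (X * (gegenPolynomial lam n * gegenPolynomial lam (n + 1))) =
      ((n : ℝ) + 2 * lam) * gegenNormSq hlam n := by
  have e : C (2 * ((n : ℝ) + 1 + lam)) *
      (X * (gegenPolynomial lam n * gegenPolynomial lam (n + 1))) =
      C ((n : ℝ) + 2) * (gegenPolynomial lam n * gegenPolynomial lam (n + 2)) +
      C ((n : ℝ) + 2 * lam) * (gegenPolynomial lam n * gegenPolynomial lam n) := by
    linear_combination -gegenPolynomial lam n * gegenPolynomial_recurrence lam n
  have h := congrArg (gegenIntegral hlam) e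
  rw [map_add, gegenIntegral_C_mul, gegenIntegral_C_mul, gegenIntegral_C_mul,
    gegenIntegral_mul_of_ne hlam (by omega : n ≠ n + 2), mul_zero, zero_add] at h
  exact h

open Polynomial in
theorem gegenIntegral_X_mul_of_add_two_le {lam : ℝ} (hlam : -1 / 2 < lam) {m n : ℕ}
    (hmn : m + 2 ≤ n) :
    gegenIntegral hlam (X * (gegenPolynomial lam m * gegenPolynomial lam n)) = 0 := by
  obtain ⟨k, rfl⟩ : ∃ k, n = k + 1 := ⟨n - 1, by omega⟩
  have e : C (2 * ((k : ℝ) + 1 + lam)) *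
      (X * (gegenPolynomial lam m * gegenPolynomial lam (k + 1))) =
      C ((k : ℝ) + 2) * (gegenPolynomial lam m * gegenPolynomial lam (k + 2)) +
      C ((k : ℝ) + 2 * lam) * (gegenPolynomial lam m * gegenPolynomial lam k) := by
    linear_combination -gegenPolynomial lam m * gegenPolynomial_recurrence lam k
  have h := congrArg (gegenIntegral hlam) e
  rw [map_add, gegenIntegral_C_mul, gegenIntegral_C_mul, gegenIntegral_C_mul,
    gegenIntegral_mul_of_ne hlam (by omega : m ≠ k + 2),
    gegenIntegral_mul_of_ne hlam (by omega : m ≠ k), mul_zero, mul_zero, zero_add] at h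
  refine (mul_eq_zero.mp h).resolve_left ?_
  have : (0 : ℝ) ≤ k := by positivity
  have : 0 < (k : ℝ) + 1 + lam := by linarith
  positivity

open Polynomial in
theorem gegenIntegral_X_mul_self {lam : ℝ} (hlam : -1 / 2 < lam) (n : ℕ) :
    gegenIntegral hlam (X * (gegenPolynomial lam n * gegenPolynomial lam n)) = 0 := by
  cases n with
  | zero =>
    have h := gegenIntegral_by_parts hlam 1
    rw [derivative_one, mul_zero, zero_sub, map_neg, neg_eq_zero, mul_assoc,
      gegenIntegral_C_mul] at h
    simpa [gegenPolynomial] using (mul_eq_zero.mp h).resolve_left (by linarith)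
  | succ k =>
    have e : C (2 * ((k : ℝ) + 1 + lam)) *
        (X * (gegenPolynomial lam (k + 1) * gegenPolynomial lam (k + 1))) =
        C ((k : ℝ) + 2) * (gegenPolynomial lam (k + 1) * gegenPolynomial lam (k + 2)) +
        C ((k : ℝ) + 2 * lam) * (gegenPolynomial lam (k + 1) * gegenPolynomial lam k) := by
      linear_combination -gegenPolynomial lam (k + 1) * gegenPolynomial_recurrence lam k
    have h := congrArg (gegenIntegral hlam) e
    rw [map_add, gegenIntegral_C_mul, gegenIntegral_C_mul, gegenIntegral_C_mul,
      gegenIntegral_mul_of_ne hlam (by omega : k + 1 ≠ k + 2),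
      gegenIntegral_mul_of_ne hlam (by omega : k + 1 ≠ k), mul_zero, mul_zero, zero_add] at h
    refine (mul_eq_zero.mp h).resolve_left ?_
    have : (0 : ℝ) ≤ k := by positivity
    have : 0 < (k : ℝ) + 1 + lam := by linarith
    positivity

open Polynomial in
theorem gegenNormSq_succ {lam : ℝ} (hlam : -1 / 2 < lam) (n : ℕ) :
    ((n : ℝ) + 1) * gegenNormSq hlam (n + 1) = 2 * ((n : ℝ) + lam) *
      gegenIntegral hlam (X * (gegenPolynomial lam n * gegenPolynomial lam (n + 1))) := by
  cases n with
  | zero =>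
    have e : gegenPolynomial lam 1 * gegenPolynomial lam 1 =
        C (2 * lam) * (X * (gegenPolynomial lam 0 * gegenPolynomial lam 1)) := by
      simp only [gegenPolynomial]
      ring
    rw [gegenNormSq, e, gegenIntegral_C_mul]
    simp
  | succ k =>
    have e : C ((k : ℝ) + 2) * (gegenPolynomial lam (k + 2) * gegenPolynomial lam (k + 2)) =
        C (2 * ((k : ℝ) + 1 + lam)) *
          (X * (gegenPolynomial lam (k + 1) * gegenPolynomial lam (k + 2))) -
        C ((k : ℝ) + 2 * lam) * (gegenPolynomial lam k * gegenPolynomial lam (k + 2)) := by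
      linear_combination gegenPolynomial lam (k + 2) * gegenPolynomial_recurrence lam k
    have h := congrArg (gegenIntegral hlam) e
    rw [map_sub, gegenIntegral_C_mul, gegenIntegral_C_mul, gegenIntegral_C_mul,
      gegenIntegral_mul_of_ne hlam (by omega : k ≠ k + 2), mul_zero, sub_zero] at h
    push_cast
    rw [← h, gegenNormSq]
    ring

theorem gegenNormSq_pos {lam : ℝ} (hlam : -1 / 2 < lam) (hlam0 : lam ≠ 0) (n : ℕ) :
    0 < gegenNormSq hlam n := by
  induction n with
  | zero =>
    simpa [gegenNormSq, gegenPolynomial] using gegenIntegral_one_pos hlam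
  | succ n ih =>
    have h1 := gegenNormSq_succ hlam n
    have h2 := gegenIntegral_X_mul_succ hlam n
    have hn : (0 : ℝ) ≤ n := by positivity
    have hp : 0 < (n : ℝ) + 1 + lam := by linarith
    have hq : 0 < ((n : ℝ) + lam) * ((n : ℝ) + 2 * lam) := by
      rcases n.eq_zero_or_pos with rfl | hn
      · have := sq_pos_of_ne_zero hlam0
        push_cast
        nlinarith
      · have : (1 : ℝ) ≤ n := by exact_mod_cast hn
        exact mul_pos (by linarith) (by linarith)
    have h3 : gegenNormSq hlam (n + 1) * (((n : ℝ) + 1) * ((n : ℝ) + 1 + lam)) =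
        ((n : ℝ) + lam) * ((n : ℝ) + 2 * lam) * gegenNormSq hlam n := by
      linear_combination ((n : ℝ) + 1 + lam) * h1 + ((n : ℝ) + lam) * h2
    exact pos_of_mul_pos_left (by rw [h3]; positivity) (by positivity)

theorem gegenGamma_mul_sqrt {lam : ℝ} (hlam : -1 / 2 < lam) (hlam0 : lam ≠ 0) {n : ℕ}
    (hn : 1 ≤ n) :
    2 * gegenIntegral hlam
      (Polynomial.X * (gegenPolynomial lam n * gegenPolynomial lam (n + 1))) =
      gegenGamma lam n * (√(gegenNormSq hlam n) * √(gegenNormSq hlam (n + 1))) := by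
  have h1 := gegenNormSq_succ hlam n
  have h2 := gegenIntegral_X_mul_succ hlam n
  have p0 := gegenNormSq_pos hlam hlam0 n
  set κ := gegenIntegral hlam
      (Polynomial.X * (gegenPolynomial lam n * gegenPolynomial lam (n + 1)))
  have hn' : (1 : ℝ) ≤ n := by exact_mod_cast hn
  have q1 : 0 < (n : ℝ) + 1 + lam := by linarith
  have q2 : 0 < (n : ℝ) + 2 * lam := by linarith
  have q3 : 0 < (n : ℝ) + lam := by linarith
  have hκ : 0 ≤ 2 * κ := by
    have : κ = ((n : ℝ) + 2 * lam) * gegenNormSq hlam n / (2 * ((n : ℝ) + 1 + lam)) := by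
      field_simp
      linear_combination h2
    rw [this]
    positivity
  rw [gegenGamma, ← Real.sqrt_mul p0.le, ← Real.sqrt_mul (by positivity)]
  refine (Real.sqrt_eq_iff_mul_self_eq (by
    have := gegenNormSq_pos hlam hlam0 (n + 1)
    positivity) hκ).mpr ?_ |>.symm
  have e1 : gegenNormSq hlam (n + 1) = 2 * ((n : ℝ) + lam) * κ / (n + 1) := by
    field_simp
    linear_combination h1
  have e2 : gegenNormSq hlam n = 2 * ((n : ℝ) + 1 + lam) * κ / (n + 2 * lam) := by
    field_simp
    linear_combination -h2
  rw [e1, e2]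
  field_simp
  ring

open Polynomial in
theorem gegenIntegral_sum_mul {lam : ℝ} (hlam : -1 / 2 < lam) (a : ℕ → ℝ) (K m : ℕ) :
    gegenIntegral hlam ((∑ n ∈ Finset.range K, C (a n) * gegenPolynomial lam n) *
      gegenPolynomial lam m) = if m < K then a m * gegenNormSq hlam m else 0 := by
  rw [Finset.sum_mul, map_sum]
  simp only [mul_assoc, gegenIntegral_C_mul]
  split_ifs with h
  · rw [Finset.sum_eq_single_of_mem m (Finset.mem_range.mpr h)]
    · rfl
    · intro b _ hb
      rw [gegenIntegral_mul_of_ne hlam hb, mul_zero]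
  · refine Finset.sum_eq_zero fun b hb => ?_
    have := Finset.mem_range.mp hb
    rw [gegenIntegral_mul_of_ne hlam (by omega), mul_zero]

open Polynomial in
theorem gegenIntegral_sum_sq {lam : ℝ} (hlam : -1 / 2 < lam) (a : ℕ → ℝ) (K : ℕ) :
    gegenIntegral hlam ((∑ n ∈ Finset.range K, C (a n) * gegenPolynomial lam n) ^ 2) =
      ∑ n ∈ Finset.range K, a n ^ 2 * gegenNormSq hlam n := by
  rw [sq, Finset.mul_sum, map_sum]
  refine Finset.sum_congr rfl fun m hm => ?_
  rw [mul_left_comm, gegenIntegral_C_mul, gegenIntegral_sum_mul,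
    if_pos (Finset.mem_range.mp hm)]
  ring

open Polynomial in
theorem gegenIntegral_X_mul_sum_sq {lam : ℝ} (hlam : -1 / 2 < lam) (b : ℕ → ℝ) (K : ℕ) :
    gegenIntegral hlam
      (X * (∑ n ∈ Finset.range (K + 1), C (b n) * gegenPolynomial lam n) ^ 2) =
      ∑ n ∈ Finset.range K, b n * b (n + 1) *
        (2 * gegenIntegral hlam (X * (gegenPolynomial lam n * gegenPolynomial lam (n + 1)))) := by
  induction K with
  | zero =>
    have e : X * (C (b 0) * gegenPolynomial lam 0) ^ 2 =
        C (b 0 * b 0) * (X * (gegenPolynomial lam 0 * gegenPolynomial lam 0)) := by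
      rw [C_mul]
      ring
    simp only [zero_add, Finset.range_one, Finset.sum_singleton, Finset.range_zero,
      Finset.sum_empty]
    rw [e, gegenIntegral_C_mul, gegenIntegral_X_mul_self, mul_zero]
  | succ K ih =>
    rw [Finset.sum_range_succ (fun n => b n * b (n + 1) * _), ← ih,
      Finset.sum_range_succ _ (K + 1)]
    have hcross : gegenIntegral hlam (X * ((∑ n ∈ Finset.range (K + 1),
        C (b n) * gegenPolynomial lam n) * gegenPolynomial lam (K + 1))) =
        b K * gegenIntegral hlam (X * (gegenPolynomial lam K * gegenPolynomial lam (K + 1))) := by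
      rw [Finset.sum_mul, Finset.mul_sum, map_sum, Finset.sum_range_succ, Finset.sum_eq_zero]
      · rw [zero_add, mul_assoc, mul_left_comm, gegenIntegral_C_mul]
      · intro j hj
        have := Finset.mem_range.mp hj
        rw [mul_assoc, mul_left_comm, gegenIntegral_C_mul,
          gegenIntegral_X_mul_of_add_two_le hlam (by omega), mul_zero]
    set S := ∑ n ∈ Finset.range (K + 1), C (b n) * gegenPolynomial lam n
    have e : X * (S + C (b (K + 1)) * gegenPolynomial lam (K + 1)) ^ 2 =
        X * S ^ 2 + C (2 * b (K + 1)) * (X * (S * gegenPolynomial lam (K + 1))) +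
        C (b (K + 1) * b (K + 1)) *
          (X * (gegenPolynomial lam (K + 1) * gegenPolynomial lam (K + 1))) := by
      have e3 : (C (2 : ℝ) : ℝ[X]) = 2 := rfl
      rw [C_mul, C_mul, e3]
      ring
    rw [e, map_add, map_add, gegenIntegral_C_mul, gegenIntegral_C_mul,
      gegenIntegral_X_mul_self, hcross]
    ring

theorem gegenCoeff_eval {lam : ℝ} (hlam : -1 / 2 < lam) (f : Polynomial ℝ) (n : ℕ) :
    gegenCoeff lam (fun t => f.eval t) n =
      (√(gegenNorm lam n))⁻¹ * gegenConst lam * gegenIntegral hlam (f * gegenPolynomial lam n) := by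
  simp only [gegenCoeff, gegenIntegral_apply, Polynomial.eval_mul, eval_gegenPolynomial]

theorem gegenConst_pos {lam : ℝ} (hlam : -1 / 2 < lam) : 0 < gegenConst lam := by
  have h1 := Real.Gamma_pos_of_pos (show 0 < lam + 1 by linarith)
  have h2 := Real.Gamma_pos_of_pos (show 0 < lam + 1 / 2 by linarith)
  have := Real.pi_pos
  rw [gegenConst]
  positivity

/-- The Hardy–Rellich inequality for polynomials, expressed through the coefficients of `g` in the
orthonormal basis, is an inequality for finitely supported sequences. -/
theorem discrete_inequality_of_hardy_rellich {lam : ℝ} (hlam : -1 / 2 < lam)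
    (hlam0 : lam ≠ 0) {n₀ : ℕ} {C : ℝ}
    (hineq : ∀ f g : Polynomial ℝ,
      (∀ j : ℕ, j ≤ n₀ → gegenCoeff lam (fun t => f.eval t) j = 0) →
      gegenCoeff lam (fun t => g.eval t) 0 = 0 →
      (∀ n : ℕ, 1 ≤ n →
        gegenCoeff lam (fun t => g.eval t) n =
          Real.sqrt ((n : ℝ) * ((n : ℝ) + 2 * lam)) * gegenCoeff lam (fun t => f.eval t) n) →
      gegenConst lam * ∫ t in (-1 : ℝ)..1, (f.eval t) ^ 2 * gegenWeight lam t ≤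
        C * (gegenConst lam * ∫ t in (-1 : ℝ)..1, (1 - t) * (g.eval t) ^ 2 * gegenWeight lam t))
    (u : ℕ → ℝ) (K : ℕ) (hu : ∀ n ≤ n₀, u n = 0) (huK : u K = 0) :
    ∑ n ∈ Finset.range K, u n ^ 2 / ((n : ℝ) * (n + 2 * lam)) ≤
      C * (∑ n ∈ Finset.range K, u n ^ 2 -
        ∑ n ∈ Finset.range K, gegenGamma lam n * (u n * u (n + 1))) := by
  have hpos : ∀ n : ℕ, 1 ≤ n → 0 < (n : ℝ) * (n + 2 * lam) := by
    intro n hn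
    have : (1 : ℝ) ≤ n := by exact_mod_cast hn
    exact mul_pos (by linarith) (by linarith)
  have hH := gegenNormSq_pos hlam hlam0
  set b : ℕ → ℝ := fun n => u n / √(gegenNormSq hlam n) with hb
  set a : ℕ → ℝ := fun n => b n / √((n : ℝ) * (n + 2 * lam)) with ha
  have hb0 : ∀ n ≤ n₀, b n = 0 := fun n hn => by simp [hb, hu n hn]
  have hab : ∀ n : ℕ, 1 ≤ n → b n = √((n : ℝ) * (n + 2 * lam)) * a n := by
    intro n hn
    have := Real.sqrt_pos.mpr (hpos n hn)
    simp only [ha]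
    field_simp
  have hbu : ∀ n, b n ^ 2 * gegenNormSq hlam n = u n ^ 2 := by
    intro n
    have := (hH n).ne'
    simp only [hb, div_pow, Real.sq_sqrt (hH n).le]
    field_simp
  have key := hineq (∑ n ∈ Finset.range (K + 1), Polynomial.C (a n) * gegenPolynomial lam n)
    (∑ n ∈ Finset.range (K + 1), Polynomial.C (b n) * gegenPolynomial lam n) ?_ ?_ ?_
  · have hf := gegenIntegral_sum_sq hlam a (K + 1)
    have hg := gegenIntegral_sum_sq hlam b (K + 1)
    have hXg := gegenIntegral_X_mul_sum_sq hlam b K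
    set f := ∑ n ∈ Finset.range (K + 1), Polynomial.C (a n) * gegenPolynomial lam n
    set g := ∑ n ∈ Finset.range (K + 1), Polynomial.C (b n) * gegenPolynomial lam n
    have e1 : ∫ t in (-1 : ℝ)..1, (f.eval t) ^ 2 * gegenWeight lam t =
        gegenIntegral hlam (f ^ 2) := by
      simp only [gegenIntegral_apply, Polynomial.eval_pow]
    have e2 : ∫ t in (-1 : ℝ)..1, (1 - t) * (g.eval t) ^ 2 * gegenWeight lam t =
        gegenIntegral hlam (g ^ 2) - gegenIntegral hlam (Polynomial.X * g ^ 2) := by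
      rw [← map_sub, gegenIntegral_apply]
      congr 1
      ext t
      simp only [Polynomial.eval_sub, Polynomial.eval_mul, Polynomial.eval_pow,
        Polynomial.eval_X]
      ring
    rw [e1, e2, hf, hg, hXg, mul_left_comm] at key
    have key := le_of_mul_le_mul_left key (gegenConst_pos hlam)
    have s1 : ∑ n ∈ Finset.range (K + 1), a n ^ 2 * gegenNormSq hlam n =
        ∑ n ∈ Finset.range K, u n ^ 2 / ((n : ℝ) * (n + 2 * lam)) := by
      rw [Finset.sum_range_succ]
      have hK : a K = 0 := by simp [ha, hb, huK]
      rw [hK]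
      simp only [ne_eq, OfNat.ofNat_ne_zero, not_false_eq_true, zero_pow, zero_mul, add_zero]
      refine Finset.sum_congr rfl fun n _ => ?_
      rcases n.eq_zero_or_pos with rfl | hn
      · simp [ha]
      · rw [← hbu]
        simp only [ha, div_pow, Real.sq_sqrt (hpos n hn).le]
        ring
    have s2 : ∑ n ∈ Finset.range (K + 1), b n ^ 2 * gegenNormSq hlam n =
        ∑ n ∈ Finset.range K, u n ^ 2 := by
      simp only [hbu]
      rw [Finset.sum_range_succ, huK]
      simp
    rw [s1, s2] at key
    refine key.trans_eq ?_
    congr 2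
    refine Finset.sum_congr rfl fun n _ => ?_
    rcases n.eq_zero_or_pos with rfl | hn
    · simp [hb0 0 (Nat.zero_le _), hu 0 (Nat.zero_le _)]
    · rw [gegenGamma_mul_sqrt hlam hlam0 hn]
      have h1 := Real.sqrt_pos.mpr (hH n)
      have h2 := Real.sqrt_pos.mpr (hH (n + 1))
      simp only [hb]
      field_simp
  · intro j hj
    rw [gegenCoeff_eval hlam, gegenIntegral_sum_mul]
    simp [ha, hb0 j hj]
  · rw [gegenCoeff_eval hlam, gegenIntegral_sum_mul]
    simp [hb0 0 (Nat.zero_le _)]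
  · intro n hn
    rw [gegenCoeff_eval hlam, gegenCoeff_eval hlam, gegenIntegral_sum_mul, gegenIntegral_sum_mul]
    split_ifs
    · rw [hab n hn]
      ring
    · simp

/-- The constant `4` in the discrete Hardy inequality is optimal, even among sequences supported in a
finite subset of `[N, ∞)`. -/
theorem exists_almost_hardy_extremal (N : ℕ) (hN : 1 ≤ N) {ε : ℝ} (hε : 0 < ε) :
    ∃ (u : ℕ → ℝ) (K : ℕ), (∀ n < N, u n = 0) ∧ u K = 0 ∧
      0 < ∑ n ∈ Finset.range K, u n ^ 2 / (n : ℝ) ^ 2 ∧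
      ∑ n ∈ Finset.range K, (u (n + 1) - u n) ^ 2 ≤
        (1 / 4 + ε) * ∑ n ∈ Finset.range K, u n ^ 2 / (n : ℝ) ^ 2 := by
  have hdiv := (not_summable_iff_tendsto_nat_atTop_of_nonneg
    (fun n : ℕ => by positivity)).mp Real.not_summable_one_div_natCast
  obtain ⟨M, hM, hNM⟩ := ((hdiv.eventually_ge_atTop
    (∑ n ∈ Finset.range N, 1 / (n : ℝ) + (N + 1) / ε)).and
    (Filter.eventually_ge_atTop N)).exists
  have hM0 : (0 : ℝ) < M := by exact_mod_cast (show 0 < M by omega)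
  have hsM := Real.sqrt_pos.mpr hM0
  set u : ℕ → ℝ := fun n => if n < N then 0 else if n < M then √n else
    if n < M + M then (2 * M - n) / √M else 0 with hu
  have u0 : ∀ n < N, u n = 0 := fun n hn => by simp [hu, hn]
  have u1 : ∀ n, N ≤ n → n ≤ M → u n = √n := by
    intro n h1 h2
    rcases h2.lt_or_eq with h2 | rfl
    · simp [hu, h1.not_gt, h2]
    · have h3 : n < n + n := by omega
      simp only [hu, h1.not_gt, h3, if_true, if_false, lt_irrefl]
      field_simp
      rw [Real.sq_sqrt hM0.le]
      ring
  have u2 : ∀ n, M ≤ n → n ≤ M + M → u n = (2 * M - n) / √M := by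
    intro n h1 h2
    rcases h2.lt_or_eq with h2 | rfl
    · simp [hu, h1.not_gt, h2, (hNM.trans h1).not_gt]
    · have h3 : ¬ (M + M < N) := by omega
      simp only [hu, h3, if_false, lt_irrefl, not_lt.mpr h1]
      push_cast
      ring
  set S := ∑ n ∈ Finset.range (M + M), u n ^ 2 / (n : ℝ) ^ 2 with hS
  have hS1 : (N + 1) / ε ≤ S := by
    have h1 : ∑ n ∈ Finset.Ico N M, 1 / (n : ℝ) ≤ S := by
      calc ∑ n ∈ Finset.Ico N M, 1 / (n : ℝ)
          = ∑ n ∈ Finset.Ico N M, u n ^ 2 / (n : ℝ) ^ 2 := by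
            refine Finset.sum_congr rfl fun n hn => ?_
            obtain ⟨h1, h2⟩ := Finset.mem_Ico.mp hn
            have : (0 : ℝ) < n := by exact_mod_cast (show 0 < n by omega)
            rw [u1 n h1 h2.le, Real.sq_sqrt this.le]
            field_simp
        _ ≤ S := by
            refine Finset.sum_le_sum_of_subset_of_nonneg ?_ fun n _ _ => by positivity
            intro n hn
            have := Finset.mem_Ico.mp hn
            exact Finset.mem_range.mpr (by omega)
    rw [Finset.sum_Ico_eq_sub _ hNM] at h1
    linarith
  refine ⟨u, M + M, u0, ?_, ?_, ?_⟩
  · rw [u2 _ (by omega) le_rfl]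
    push_cast
    ring_nf
  · exact lt_of_lt_of_le (by positivity) hS1
  · have hpt : ∀ n ∈ Finset.range (M + M), (u (n + 1) - u n) ^ 2 ≤
        (if n = N - 1 then (N : ℝ) else 0) + 1 / 4 * (u n ^ 2 / (n : ℝ) ^ 2) +
          (if n < M then 0 else 1 / (M : ℝ)) := by
      intro n hn
      have hn := Finset.mem_range.mp hn
      have hc : (0 : ℝ) ≤ if n < M then 0 else 1 / (M : ℝ) := by
        split_ifs <;> positivity
      have hb : (0 : ℝ) ≤ if n = N - 1 then (N : ℝ) else 0 := by
        split_ifs <;> positivity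
      have ha : (0 : ℝ) ≤ 1 / 4 * (u n ^ 2 / (n : ℝ) ^ 2) := by positivity
      rcases lt_trichotomy (n + 1) N with h | h | h
      · rw [u0 _ h, u0 n (by omega), sub_zero, zero_pow two_ne_zero] at *
        linarith
      · rw [u1 _ h.ge (by omega), u0 n (by omega), sub_zero, Real.sq_sqrt (by positivity),
          if_pos (by omega), h]
        simp only [ne_eq, OfNat.ofNat_ne_zero, not_false_eq_true, zero_pow, zero_div, mul_zero]
        linarith
      · rcases lt_or_ge n M with h' | h'
        · have hn0 : (0 : ℝ) < n := by exact_mod_cast (show 0 < n by omega)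
          rw [u1 _ (by omega) (by omega), u1 n (by omega) h'.le] at *
          have hs := Real.sqrt_pos.mpr hn0
          have hs2 := Real.sq_sqrt hn0.le
          have ht2 := Real.sq_sqrt (show (0 : ℝ) ≤ (n + 1 : ℕ) by positivity)
          have hst : √(n : ℝ) ≤ √((n + 1 : ℕ) : ℝ) := Real.sqrt_le_sqrt (by push_cast; linarith)
          push_cast at ht2 hst ⊢
          set s := √(n : ℝ)
          set t := √((n : ℝ) + 1)
          have hd : t - s ≤ 1 / (2 * s) := by
            rw [le_div_iff₀ (by positivity)]
            nlinarith
          have hsq : (t - s) ^ 2 ≤ (1 / (2 * s)) ^ 2 :=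
            pow_le_pow_left₀ (by linarith) hd 2
          have e : (1 / (2 * s)) ^ 2 = 1 / 4 * (s ^ 2 / (n : ℝ) ^ 2) := by
            rw [← hs2]
            field_simp
            norm_num
          linarith
        · rw [u2 _ (by omega) (by omega), u2 n h' hn.le] at *
          have e : ((2 * (M : ℝ) - ((n + 1 : ℕ) : ℝ)) / √M - (2 * M - n) / √M) ^ 2 = 1 / M := by
            push_cast
            rw [← sub_div, div_pow, Real.sq_sqrt hM0.le]
            ring
          rw [e, if_neg h'.not_gt] at *
          linarith
    have hsum := Finset.sum_le_sum hpt
    rw [Finset.sum_add_distrib, Finset.sum_add_distrib, ← Finset.mul_sum, ← hS,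
      Finset.sum_ite_eq' (Finset.range (M + M)) (N - 1) fun _ => (N : ℝ),
      if_pos (Finset.mem_range.mpr (by omega)),
      Finset.sum_range_add (fun n => if n < M then (0 : ℝ) else 1 / (M : ℝ))] at hsum
    have z1 : ∑ n ∈ Finset.range M, (if n < M then (0 : ℝ) else 1 / (M : ℝ)) = 0 :=
      Finset.sum_eq_zero fun n hn => if_pos (Finset.mem_range.mp hn)
    have z2 : ∑ n ∈ Finset.range M, (if M + n < M then (0 : ℝ) else 1 / (M : ℝ)) = 1 := by
      simp [hM0.ne']
    rw [z1, z2] at hsum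
    have := (div_le_iff₀ hε).mp hS1
    linarith

open Filter Topology in
theorem tendsto_natCast_add_div_natCast_add (a b : ℝ) :
    Tendsto (fun n : ℕ => ((n : ℝ) + a) / (n + b)) atTop (𝓝 1) := by
  have h := (tendsto_natCast_div_add_atTop b).mul
    ((tendsto_natCast_div_add_atTop a).inv₀ one_ne_zero)
  simp only [inv_one, mul_one] at h
  refine h.congr' ?_
  filter_upwards [eventually_gt_atTop 0] with n hn
  have hn : (n : ℝ) ≠ 0 := by exact_mod_cast hn.ne'
  rw [inv_div, mul_comm, div_mul_div_cancel₀ hn]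

open Filter Topology in
theorem tendsto_gegenGamma (lam : ℝ) :
    Tendsto (gegenGamma lam) atTop (𝓝 1) := by
  have h := ((tendsto_natCast_add_div_natCast_add (2 * lam) lam).mul
    (tendsto_natCast_add_div_natCast_add 1 (lam + 1))).sqrt
  simp only [mul_one, Real.sqrt_one] at h
  refine h.congr fun n => ?_
  rw [gegenGamma, div_mul_div_comm, add_assoc _ lam 1]

open Filter Topology in
theorem tendsto_sq_mul_one_sub_gegenGamma {lam : ℝ} (hlam : -1 / 2 < lam) (a : ℝ) :
    Tendsto (fun n : ℕ => ((n : ℝ) + a) ^ 2 * (1 - gegenGamma lam n)) atTop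
      (𝓝 (lam * (lam - 1) / 2)) := by
  have h := (((tendsto_natCast_add_div_natCast_add a lam).mul
    (tendsto_natCast_add_div_natCast_add a (lam + 1))).const_mul (lam * (lam - 1))).div
    ((tendsto_gegenGamma lam).const_add 1) (by norm_num)
  norm_num at h
  refine h.congr' ?_
  filter_upwards [eventually_ge_atTop 1] with n hn
  have hn' : (1 : ℝ) ≤ n := by exact_mod_cast hn
  have q1 : 0 < (n : ℝ) + lam + 1 := by linarith
  have q2 : 0 < (n : ℝ) + 2 * lam := by linarith
  have q3 : 0 < (n : ℝ) + lam := by linarith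
  have hsq : gegenGamma lam n ^ 2 =
      ((n : ℝ) + 2 * lam) * ((n : ℝ) + 1) / (((n : ℝ) + lam) * ((n : ℝ) + lam + 1)) :=
    Real.sq_sqrt (by positivity)
  have hγ : 0 ≤ gegenGamma lam n := Real.sqrt_nonneg _
  rw [eq_div_iff (by positivity)] at hsq
  simp only [Pi.div_apply]
  rw [← add_assoc, div_mul_div_comm, mul_div_assoc', div_div, div_eq_iff (by positivity)]
  linear_combination ((n : ℝ) + a) ^ 2 * hsq

theorem sum_sq_sub_sum_mul_le {γ u : ℕ → ℝ} {K N : ℕ} {κ δ : ℝ} (hN : 1 ≤ N)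
    (hu0 : ∀ n ≤ N, u n = 0) (huK : u K = 0) (hγ : ∀ n, N ≤ n → γ n ≤ 1 + δ)
    (hγ0 : ∀ n : ℕ, N ≤ n → (n : ℝ) ^ 2 * (1 - γ n) ≤ κ)
    (hγ1 : ∀ n : ℕ, N ≤ n → ((n : ℝ) + 1) ^ 2 * (1 - γ n) ≤ κ) :
    ∑ n ∈ Finset.range K, u n ^ 2 - ∑ n ∈ Finset.range K, γ n * (u n * u (n + 1)) ≤
      κ * ∑ n ∈ Finset.range K, u n ^ 2 / (n : ℝ) ^ 2 +
        (1 + δ) / 2 * ∑ n ∈ Finset.range K, (u (n + 1) - u n) ^ 2 := by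
  have shift : ∀ v : ℕ → ℝ, v 0 = 0 → v K = 0 →
      ∑ n ∈ Finset.range K, v (n + 1) = ∑ n ∈ Finset.range K, v n := by
    intro v h0 hK
    have h1 := Finset.sum_range_succ v K
    rw [Finset.sum_range_succ', h0, hK] at h1
    linarith
  have z0 : u 0 = 0 := hu0 0 (Nat.zero_le _)
  have s1 := shift (fun n => u n ^ 2) (by simp [z0]) (by simp [huK])
  have s2 := shift (fun n => u n ^ 2 / (n : ℝ) ^ 2) (by simp [z0]) (by simp [huK])
  have hpt : ∀ n ∈ Finset.range K,
      1 / 2 * u n ^ 2 + 1 / 2 * u (n + 1) ^ 2 - γ n * (u n * u (n + 1)) ≤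
      κ / 2 * (u n ^ 2 / (n : ℝ) ^ 2) + κ / 2 * (u (n + 1) ^ 2 / ((n + 1 : ℕ) : ℝ) ^ 2) +
        (1 + δ) / 2 * (u (n + 1) - u n) ^ 2 := by
    intro n _
    rcases lt_or_ge n N with h | h
    · simp [hu0 n h.le, hu0 (n + 1) h]
    · have hn : (0 : ℝ) < n := by exact_mod_cast (show 0 < n by omega)
      have h0 : 1 - γ n ≤ κ / (n : ℝ) ^ 2 := by
        rw [le_div_iff₀ (by positivity), mul_comm]
        exact hγ0 n h
      have h1 : 1 - γ n ≤ κ / ((n + 1 : ℕ) : ℝ) ^ 2 := by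
        rw [le_div_iff₀ (by positivity), mul_comm]
        push_cast
        exact hγ1 n h
      have e0 := mul_le_mul_of_nonneg_left h0 (sq_nonneg (u n))
      have e1 := mul_le_mul_of_nonneg_left h1 (sq_nonneg (u (n + 1)))
      have e2 := mul_le_mul_of_nonneg_left (hγ n h) (sq_nonneg (u (n + 1) - u n))
      have r0 : u n ^ 2 * (κ / (n : ℝ) ^ 2) = κ * (u n ^ 2 / (n : ℝ) ^ 2) := by ring
      have r1 : u (n + 1) ^ 2 * (κ / ((n + 1 : ℕ) : ℝ) ^ 2) =
        κ * (u (n + 1) ^ 2 / ((n + 1 : ℕ) : ℝ) ^ 2) := by ring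
      rw [r0] at e0
      rw [r1] at e1
      linarith
  have hsum := Finset.sum_le_sum hpt
  simp only [Finset.sum_add_distrib, Finset.sum_sub_distrib, ← Finset.mul_sum] at hsum
  rw [s1, s2] at hsum
  linarith

/-- **Theorem 3.6 (necessity).** Let `λ > -1/2`, `λ ∉ {0, 1/2}`, and `n₀ ∈ ℕ`. If `C > 0` is
such that for every real polynomial `f` with `f̂_j^λ = 0` for all `0 ≤ j ≤ n₀`, with `g` the
polynomial with `ĝ_0^λ = 0` and `ĝ_n^λ = (n(n+2λ))^{1/2} f̂_n^λ` for `n ≥ 1`, one has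
`c_λ ∫ f² w_λ ≤ C c_λ ∫ (1-t) g² w_λ`, then `C ≥ 8/(2λ-1)²`. -/
theorem hardy_rellich_gegenbauer_optimal (lam : ℝ) (hlam : -1 / 2 < lam)
    (hlam0 : lam ≠ 0) (hlamhalf : lam ≠ 1 / 2) (n₀ : ℕ) (C : ℝ) (hC : 0 < C)
    (hineq : ∀ f g : Polynomial ℝ,
      (∀ j : ℕ, j ≤ n₀ → gegenCoeff lam (fun t => f.eval t) j = 0) →
      gegenCoeff lam (fun t => g.eval t) 0 = 0 →
      (∀ n : ℕ, 1 ≤ n →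
        gegenCoeff lam (fun t => g.eval t) n =
          Real.sqrt ((n : ℝ) * ((n : ℝ) + 2 * lam)) * gegenCoeff lam (fun t => f.eval t) n) →
      gegenConst lam * ∫ t in (-1 : ℝ)..1, (f.eval t) ^ 2 * gegenWeight lam t ≤
        C * (gegenConst lam * ∫ t in (-1 : ℝ)..1, (1 - t) * (g.eval t) ^ 2 * gegenWeight lam t)) :
    8 / (2 * lam - 1) ^ 2 ≤ C := by
  have hstep : ∀ ε : ℝ, 0 < ε →
      1 - ε ≤ C * (lam * (lam - 1) / 2 + ε + (1 + ε) / 2 * (1 / 4 + ε)) := by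
    intro ε hε
    have hγ := (tendsto_gegenGamma lam).eventually_le_const (show 1 < 1 + ε by linarith)
    have hlt : lam * (lam - 1) / 2 < lam * (lam - 1) / 2 + ε := by linarith
    have hγ0 := (tendsto_sq_mul_one_sub_gegenGamma hlam 0).eventually_le_const hlt
    have hγ1 := (tendsto_sq_mul_one_sub_gegenGamma hlam 1).eventually_le_const hlt
    have hr := (tendsto_natCast_add_div_natCast_add 0 (2 * lam)).eventually_const_le
      (show 1 - ε < 1 by linarith)
    obtain ⟨N, hN⟩ := Filter.eventually_atTop.mp
      ((hγ.and (hγ0.and (hγ1.and hr))).and (Filter.eventually_ge_atTop (n₀ + 1)))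
    have hNn : n₀ + 1 ≤ N := (hN N le_rfl).2
    obtain ⟨u, K, hu0, huK, hSpos, hD⟩ := exists_almost_hardy_extremal (N + 1) (by omega) hε
    have hu0' : ∀ n ≤ N, u n = 0 := fun n hn => hu0 n (by omega)
    have hmain := discrete_inequality_of_hardy_rellich hlam hlam0 hineq u K
      (fun n hn => hu0' n (by omega)) huK
    have hQ := sum_sq_sub_sum_mul_le (γ := gegenGamma lam) (κ := lam * (lam - 1) / 2 + ε) (δ := ε)
      (by omega) hu0' huK (fun n hn => (hN n hn).1.1)
      (fun n hn => by simpa using (hN n hn).1.2.1) (fun n hn => (hN n hn).1.2.2.1)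
    have hL : (1 - ε) * ∑ n ∈ Finset.range K, u n ^ 2 / (n : ℝ) ^ 2 ≤
        ∑ n ∈ Finset.range K, u n ^ 2 / ((n : ℝ) * (n + 2 * lam)) := by
      rw [Finset.mul_sum]
      refine Finset.sum_le_sum fun n _ => ?_
      rcases le_or_gt n N with h | h
      · simp [hu0' n h]
      · have hn : (1 : ℝ) ≤ n := by exact_mod_cast (show 1 ≤ n by omega)
        have hn2 : 0 < (n : ℝ) + 2 * lam := by linarith
        have hn0 : (0 : ℝ) < n := by linarith
        have h1 := (hN n h.le).1.2.2.2
        rw [add_zero] at h1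
        have h2 := mul_le_mul_of_nonneg_right h1
          (show 0 ≤ u n ^ 2 / (n : ℝ) ^ 2 by positivity)
        refine h2.trans_eq ?_
        field_simp
    set S := ∑ n ∈ Finset.range K, u n ^ 2 / (n : ℝ) ^ 2
    have hD' := mul_le_mul_of_nonneg_left hD (show 0 ≤ (1 + ε) / 2 by linarith)
    have hQ' := mul_le_mul_of_nonneg_left (hQ.trans (add_le_add_right hD' _)) hC.le
    refine le_of_mul_le_mul_right ?_ hSpos
    linarith
  have hlim : 1 - (0 : ℝ) ≤ C * (lam * (lam - 1) / 2 + 0 + (1 + 0) / 2 * (1 / 4 + 0)) := by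
    have hc1 : Continuous fun ε : ℝ => 1 - ε := by fun_prop
    have hc2 : Continuous fun ε : ℝ =>
        C * (lam * (lam - 1) / 2 + ε + (1 + ε) / 2 * (1 / 4 + ε)) := by fun_prop
    exact le_of_tendsto_of_tendsto ((hc1.tendsto 0).mono_left nhdsWithin_le_nhds)
      ((hc2.tendsto 0).mono_left nhdsWithin_le_nhds)
      (Filter.eventually_of_mem (self_mem_nhdsWithin (s := Set.Ioi (0 : ℝ))) hstep)
  have hne : 2 * lam - 1 ≠ 0 := fun h => hlamhalf (by linarith)
  rw [div_le_iff₀ (by positivity)]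
  linarith
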